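/- Let Γ be an inverse semigroup with zero satisfying condition (L). If x, y, z ∈ Γ satisfy z ≠ 0, z < x, and z < y, then there exists a largest common precessor of x, y, and z, and it is not equal to zero: i.e. there is w ≠ 0 with w ≺ x, w ≺ y, w ≺ z, such that every v with v ≺ x, v ≺ y, v ≺ z satisfies v ≺ w. -/

import Mathlib

/-- An inverse semigroup: a semigroup in which every element `x` has a unique
element `x⁻¹` with `x * x⁻¹ * x = x` and `x⁻¹ * x * x⁻¹ = x⁻¹`. -/
class InverseSemigroup (α : Type*) extends Semigroup α, Inv α where
  mul_inv_mul : ∀ x : α, x * x⁻¹ * x = x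
  inv_mul_inv : ∀ x : α, x⁻¹ * x * x⁻¹ = x⁻¹
  inv_unique : ∀ x y : α, x * y * x = x → y * x * y = y → y = x⁻¹

variable {α : Type*} [InverseSemigroup α]

/-- The natural order on an inverse semigroup: `x ≺ y` iff `x * y⁻¹ = x * x⁻¹`. -/
def prec (x y : α) : Prop := x * y⁻¹ = x * x⁻¹

/-- The idempotents (units) `Γ⁽⁰⁾`: elements `p` with `p = p * p⁻¹`. -/
def IsIdem (p : α) : Prop := p = p * p⁻¹

/-- A zero element: `z * x = z = x * z` for every `x`. -/
def IsZeroEl (z : α) : Prop := ∀ x : α, z * x = z ∧ x * z = z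


/-- The relation x < y (w.r.t. the zero z0): every nonzero precessor of x has a
nonzero common precessor with y. -/
def lt1 (z0 x y : α) : Prop :=
  ∀ w : α, prec w x → w ≠ z0 → ∃ v : α, v ≠ z0 ∧ prec v w ∧ prec v y


namespace InverseSemigroup

theorem inv_inv' (a : α) : a⁻¹⁻¹ = a :=
  (inv_unique a⁻¹ a (inv_mul_inv a) (mul_inv_mul a)).symm

theorem inv_eq_self_of_idem {e : α} (he : e * e = e) : e⁻¹ = e :=
  (inv_unique e e (by rw [he, he]) (by rw [he, he])).symm

theorem idem_mul_idem {e f : α} (he : e * e = e) (hf : f * f = f) :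
    e * f * (e * f) = e * f := by
  have h1 := mul_inv_mul (e * f)
  have h2 := inv_mul_inv (e * f)
  generalize hx : (e * f)⁻¹ = x at h1 h2
  have hfxe : f * x * e = x := by
    rw [← hx]
    refine inv_unique _ _ ?_ ?_ <;> rw [hx]
    · calc e * f * (f * x * e) * (e * f) = e * (f * f) * x * ((e * e) * f) := by
            simp only [mul_assoc]
        _ = e * f * x * (e * f) := by rw [he, hf]
        _ = e * f := h1
    · calc f * x * e * (e * f) * (f * x * e) = f * (x * ((e * e) * (f * f)) * x) * e := by
            simp only [mul_assoc]
        _ = f * x * e := by rw [he, hf, h2]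
  have hxx : x * x = x := by
    calc x * x = (f * x * e) * (f * x * e) := by rw [hfxe]
      _ = f * (x * (e * f) * x) * e := by simp only [mul_assoc]
      _ = x := by rw [h2, hfxe]
  have hef : e * f = x := by
    rw [← inv_inv' (e * f), hx, inv_eq_self_of_idem hxx]
  rw [hef, hxx]

theorem idem_comm {e f : α} (he : e * e = e) (hf : f * f = f) : e * f = f * e := by
  have h1 := idem_mul_idem he hf
  have h2 := idem_mul_idem hf he
  rw [← inv_eq_self_of_idem h1]
  refine (inv_unique _ _ ?_ ?_).symm
  · calc e * f * (f * e) * (e * f) = e * (f * f) * ((e * e) * f) := by simp only [mul_assoc]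
      _ = e * f := by rw [he, hf, h1]
  · calc f * e * (e * f) * (f * e) = f * (e * e) * ((f * f) * e) := by simp only [mul_assoc]
      _ = f * e := by rw [he, hf, h2]

theorem mul_inv_idem (a : α) : a * a⁻¹ * (a * a⁻¹) = a * a⁻¹ := by
  rw [← mul_assoc, mul_inv_mul]

theorem inv_mul_idem (a : α) : a⁻¹ * a * (a⁻¹ * a) = a⁻¹ * a := by
  rw [← mul_assoc, inv_mul_inv]

theorem mul_inv_rev' (a b : α) : (a * b)⁻¹ = b⁻¹ * a⁻¹ := by
  have hc : b * b⁻¹ * (a⁻¹ * a) = a⁻¹ * a * (b * b⁻¹) :=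
    idem_comm (mul_inv_idem b) (inv_mul_idem a)
  refine (inv_unique _ _ ?_ ?_).symm
  · calc a * b * (b⁻¹ * a⁻¹) * (a * b) = a * (b * b⁻¹ * (a⁻¹ * a)) * b := by
          simp only [mul_assoc]
      _ = (a * a⁻¹ * a) * (b * b⁻¹ * b) := by rw [hc]; simp only [mul_assoc]
      _ = a * b := by rw [mul_inv_mul, mul_inv_mul]
  · calc b⁻¹ * a⁻¹ * (a * b) * (b⁻¹ * a⁻¹) = b⁻¹ * (a⁻¹ * a * (b * b⁻¹)) * a⁻¹ := by
          simp only [mul_assoc]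
      _ = (b⁻¹ * b * b⁻¹) * (a⁻¹ * a * a⁻¹) := by rw [← hc]; simp only [mul_assoc]
      _ = b⁻¹ * a⁻¹ := by rw [inv_mul_inv, inv_mul_inv]

end InverseSemigroup

open InverseSemigroup

theorem prec_refl (a : α) : prec a a := rfl

theorem prec.eq_mul_inv_mul {a b : α} (h : prec a b) : a = a * a⁻¹ * b := by
  have h' : b * a⁻¹ = a * a⁻¹ := by
    have := congrArg (·⁻¹) (show a * b⁻¹ = a * a⁻¹ from h)
    simpa only [mul_inv_rev', inv_inv'] using this
  have ha : b * (a⁻¹ * a) = a := by rw [← mul_assoc, h', mul_inv_mul]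
  symm
  calc a * a⁻¹ * b = a * b⁻¹ * b := by rw [show a * b⁻¹ = a * a⁻¹ from h]
    _ = b * (a⁻¹ * a) * b⁻¹ * b := by rw [ha]
    _ = b * (a⁻¹ * a * (b⁻¹ * b)) := by simp only [mul_assoc]
    _ = b * b⁻¹ * b * (a⁻¹ * a) := by
        rw [idem_comm (inv_mul_idem a) (inv_mul_idem b)]; simp only [mul_assoc]
    _ = a := by rw [mul_inv_mul, ha]

theorem prec.trans {a b c : α} (hab : prec a b) (hbc : prec b c) : prec a c := by
  calc a * c⁻¹ = a * a⁻¹ * b * c⁻¹ := by rw [← hab.eq_mul_inv_mul]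
    _ = a * a⁻¹ * (b * b⁻¹) := by rw [mul_assoc _ b, show b * c⁻¹ = b * b⁻¹ from hbc]
    _ = a * b⁻¹ := by rw [← mul_assoc, ← hab.eq_mul_inv_mul]
    _ = a * a⁻¹ := hab

theorem prec.eq_zero {z0 a : α} (hz : IsZeroEl z0) (h : prec a z0) : a = z0 := by
  rw [h.eq_mul_inv_mul, (hz _).2]

/-- if Γ has a zero and satisfies condition (L), and z ≠ 0,
z < x, z < y, then x, y, z have a largest common precessor, which is nonzero. -/
theorem stmt13 {z0 : α} (hz : IsZeroEl z0)
    (hL : ∀ a b : α, (∃ v : α, v ≠ z0 ∧ prec v a ∧ prec v b) →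
      ∃ w : α, prec w a ∧ prec w b ∧ ∀ v : α, prec v a → prec v b → prec v w)
    {x y z : α} (hz0 : z ≠ z0) (hzx : lt1 z0 z x) (hzy : lt1 z0 z y) :
    ∃ w : α, w ≠ z0 ∧ prec w x ∧ prec w y ∧ prec w z ∧
      ∀ v : α, prec v x → prec v y → prec v z → prec v w := by
  obtain ⟨v₁, hv₁, hv₁z, hv₁x⟩ := hzx z (prec_refl z) hz0
  obtain ⟨w₁, hw₁z, hw₁x, hmax₁⟩ := hL z x ⟨v₁, hv₁, hv₁z, hv₁x⟩
  have hw₁ : w₁ ≠ z0 := by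
    rintro rfl
    exact hv₁ ((hmax₁ v₁ hv₁z hv₁x).eq_zero hz)
  obtain ⟨v, hv, hvw₁, hvy⟩ := hzy w₁ hw₁z hw₁
  obtain ⟨w, hww₁, hwy, hmax⟩ := hL w₁ y ⟨v, hv, hvw₁, hvy⟩
  refine ⟨w, ?_, hww₁.trans hw₁x, hwy, hww₁.trans hw₁z, fun u hux huy huz =>
    hmax u (hmax₁ u huz hux) huy⟩
  rintro rfl
  exact hv ((hmax v hvw₁ hvy).eq_zero hz)
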